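/- Let G be a simple graph on Fin n and let C_G ⊆ PΠ_{n,2} be the split closure of the set of connected set Markov statements of G. Then for every nonempty set D ⊆ Fin n, D is disconnected with respect to C_G (i.e., D = |π| for some π ∈ C_G) if and only if the induced subgraph G[D] is disconnected. -/

import Mathlib

/-- A partial set partition of `Fin n`: a finite set of nonempty, pairwise disjoint
subsets of `Fin n`, called its blocks. -/
structure PartialSetPartition (n : ℕ) where
  blocks : Finset (Finset (Fin n))
  nonempty_of_mem : ∀ B ∈ blocks, B.Nonempty
  disjoint_of_ne : ∀ B ∈ blocks, ∀ B' ∈ blocks, B ≠ B' → Disjoint B B'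

namespace PartialSetPartition

variable {n : ℕ}

/-- The ground set `|π|` of a partial set partition: the union of its blocks. -/
def ground (π : PartialSetPartition n) : Finset (Fin n) := π.blocks.sup id

/-- The order on `PΠ_n`: `τ ≤ π` iff `|τ| ⊆ |π|` and every nonempty set of the form
`P ∩ |τ|`, with `P` a block of `π`, is contained in some block of `τ`. -/
def Le (τ π : PartialSetPartition n) : Prop :=
  τ.ground ⊆ π.ground ∧
    ∀ P ∈ π.blocks, (P ∩ τ.ground).Nonempty → ∃ B ∈ τ.blocks, P ∩ τ.ground ⊆ B

/-- Membership in `PΠ_{n,2}`: at least two blocks. -/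
def TwoBlocks (π : PartialSetPartition n) : Prop := 2 ≤ π.blocks.card

/-- `ρ` is the splitting `π^τ` of `π` by the two-block partial set partition `τ`:
some block `B` of `π` equals the union of the two blocks of `τ` (i.e. `|τ|`), and `ρ` is
obtained from `π` by replacing `B` with the two blocks of `τ`. -/
def IsSplitting (π τ ρ : PartialSetPartition n) : Prop :=
  τ.blocks.card = 2 ∧
    ∃ B ∈ π.blocks, B = τ.ground ∧ ρ.blocks = (π.blocks.erase B) ∪ τ.blocks

/-- A split closed order ideal: a subset of `PΠ_{n,2}` that is downward closed for the
order on `PΠ_n` and closed under splittings. -/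
def IsSplitClosedIdeal (C : Set (PartialSetPartition n)) : Prop :=
  (∀ π ∈ C, TwoBlocks π) ∧
    (∀ π ∈ C, ∀ τ, TwoBlocks τ → Le τ π → τ ∈ C) ∧
    (∀ π ∈ C, ∀ τ ∈ C, ∀ ρ, IsSplitting π τ ρ → ρ ∈ C)

end PartialSetPartition

namespace PartialSetPartition

/-- The split closure of `C`: the smallest split closed order ideal containing `C`. -/
def splitClosure {n : ℕ} (C : Set (PartialSetPartition n)) :
    Set (PartialSetPartition n) :=
  ⋂₀ {D | C ⊆ D ∧ IsSplitClosedIdeal D}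

/-- A nonempty set `D` is disconnected with respect to `C` if `D` is the ground set of
some element of `C`. -/
def Disconnected {n : ℕ} (C : Set (PartialSetPartition n)) (D : Finset (Fin n)) : Prop :=
  ∃ π ∈ C, π.ground = D

end PartialSetPartition

/-- The spouse set `Sp(C)` of a set of vertices: `C` together with all vertices adjacent
to some vertex of `C`. -/
def spouse {n : ℕ} (G : SimpleGraph (Fin n)) [DecidableRel G.Adj]
    (C : Finset (Fin n)) : Finset (Fin n) :=
  C ∪ Finset.univ.filter fun v => ∃ u ∈ C, G.Adj u v

/-- The connected set Markov statements of a graph `G`: the two-block partial set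
partitions `{C, V ∖ Sp(C)}` over all nonempty `C` connected in `G` with
`V ∖ Sp(C) ≠ ∅`. -/
def connectedSetMarkov {n : ℕ} (G : SimpleGraph (Fin n)) [DecidableRel G.Adj] :
    Set (PartialSetPartition n) :=
  {π | ∃ C : Finset (Fin n), C.Nonempty ∧ (G.induce (C : Set (Fin n))).Connected ∧
    (Finset.univ \ spouse G C).Nonempty ∧
    π.blocks = {C, Finset.univ \ spouse G C}}

namespace PartialSetPartition

variable {n : ℕ}

theorem mem_ground {π : PartialSetPartition n} {v : Fin n} :
    v ∈ π.ground ↔ ∃ B ∈ π.blocks, v ∈ B := by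
  simp [ground, Finset.mem_sup]

theorem eq_of_mem_of_mem (π : PartialSetPartition n) {B B' : Finset (Fin n)}
    (hB : B ∈ π.blocks) (hB' : B' ∈ π.blocks) {v : Fin n} (hv : v ∈ B) (hv' : v ∈ B') :
    B = B' := by
  by_contra h
  exact Finset.disjoint_left.mp (π.disjoint_of_ne B hB B' hB' h) hv hv'

/-- The partial set partition with blocks `A` and `B`. -/
def pair (A B : Finset (Fin n)) (hA : A.Nonempty) (hB : B.Nonempty) (hAB : Disjoint A B) :
    PartialSetPartition n where
  blocks := {A, B}
  nonempty_of_mem := by simp [hA, hB]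
  disjoint_of_ne := by
    intro P hP Q hQ hPQ
    simp only [Finset.mem_insert, Finset.mem_singleton] at hP hQ
    rcases hP with rfl | rfl <;> rcases hQ with rfl | rfl
    · exact absurd rfl hPQ
    · exact hAB
    · exact hAB.symm
    · exact absurd rfl hPQ

theorem ground_pair {A B : Finset (Fin n)} (hA : A.Nonempty) (hB : B.Nonempty)
    (hAB : Disjoint A B) : (pair A B hA hB hAB).ground = A ∪ B := by
  simp [ground, pair]

theorem twoBlocks_pair {A B : Finset (Fin n)} (hA : A.Nonempty) (hB : B.Nonempty)
    (hAB : Disjoint A B) : TwoBlocks (pair A B hA hB hAB) :=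
  (Finset.card_pair (hAB.ne hA.ne_empty)).ge

theorem pair_le_pair {A B A' B' : Finset (Fin n)} (hA : A.Nonempty) (hB : B.Nonempty)
    (hAB : Disjoint A B) (hA' : A'.Nonempty) (hB' : B'.Nonempty) (hAB' : Disjoint A' B')
    (hAA' : A ⊆ A') (hBB' : B ⊆ B') :
    Le (pair A B hA hB hAB) (pair A' B' hA' hB' hAB') := by
  rw [Le, ground_pair, ground_pair]
  refine ⟨Finset.union_subset_union hAA' hBB', fun P hP _ => ?_⟩
  simp only [pair, Finset.mem_insert, Finset.mem_singleton] at hP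
  rcases hP with rfl | rfl
  · refine ⟨A, by simp [pair], fun v hv => ?_⟩
    rw [Finset.mem_inter, Finset.mem_union] at hv
    exact hv.2.resolve_right fun h => Finset.disjoint_left.mp hAB' hv.1 (hBB' h)
  · refine ⟨B, by simp [pair], fun v hv => ?_⟩
    rw [Finset.mem_inter, Finset.mem_union] at hv
    exact hv.2.resolve_left fun h => Finset.disjoint_left.mp hAB' (hAA' h) hv.1

/-- The blocks of `π` are pairwise separated in `G`: every edge of `G` between vertices of
blocks stays in one block. -/
def IsSeparated (G : SimpleGraph (Fin n)) (π : PartialSetPartition n) : Prop :=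
  ∀ B ∈ π.blocks, ∀ B' ∈ π.blocks, ∀ u ∈ B, ∀ v ∈ B', G.Adj u v → B = B'

theorem IsSeparated.of_le {G : SimpleGraph (Fin n)} {π τ : PartialSetPartition n}
    (hπ : IsSeparated G π) (h : Le τ π) : IsSeparated G τ := by
  intro B hB B' hB' u hu v hv huv
  have hu' : u ∈ τ.ground := mem_ground.mpr ⟨B, hB, hu⟩
  have hv' : v ∈ τ.ground := mem_ground.mpr ⟨B', hB', hv⟩
  obtain ⟨P, hP, huP⟩ := mem_ground.mp (h.1 hu')
  obtain ⟨Q, hQ, hvQ⟩ := mem_ground.mp (h.1 hv')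
  obtain rfl := hπ P hP Q hQ u huP v hvQ huv
  have huI := Finset.mem_inter.mpr ⟨huP, hu'⟩
  obtain ⟨E, hE, hPE⟩ := h.2 P hP ⟨u, huI⟩
  exact (τ.eq_of_mem_of_mem hB hE hu (hPE huI)).trans
    (τ.eq_of_mem_of_mem hE hB' (hPE (Finset.mem_inter.mpr ⟨hvQ, hv'⟩)) hv)

theorem IsSeparated.of_isSplitting {G : SimpleGraph (Fin n)} {π τ ρ : PartialSetPartition n}
    (hπ : IsSeparated G π) (hτ : IsSeparated G τ) (h : IsSplitting π τ ρ) :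
    IsSeparated G ρ := by
  obtain ⟨-, A, hA, hAτ, hρ⟩ := h
  have sub : ∀ B ∈ τ.blocks, B ⊆ A := fun B hB v hv => hAτ ▸ mem_ground.mpr ⟨B, hB, hv⟩
  intro B hB B' hB' u hu v hv huv
  rw [hρ, Finset.mem_union, Finset.mem_erase] at hB hB'
  rcases hB with hB | hB <;> rcases hB' with hB' | hB'
  · exact hπ B hB.2 B' hB'.2 u hu v hv huv
  · exact absurd (hπ B hB.2 A hA u hu v (sub B' hB' hv) huv) hB.1
  · exact absurd (hπ A hA B' hB'.2 u (sub B hB hu) v hv huv).symm hB'.1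
  · exact hτ B hB B' hB' u hu v hv huv

theorem isSplitClosedIdeal_isSeparated (G : SimpleGraph (Fin n)) :
    IsSplitClosedIdeal {π | TwoBlocks π ∧ IsSeparated G π} := by
  refine ⟨fun π hπ => hπ.1, fun π hπ τ hτ h => ⟨hτ, hπ.2.of_le h⟩,
    fun π hπ τ hτ ρ h => ⟨?_, hπ.2.of_isSplitting hτ.2 h⟩⟩
  obtain ⟨hcard, A, -, -, hρ⟩ := h
  rw [TwoBlocks, hρ, ← hcard]
  exact Finset.card_le_card Finset.subset_union_right

theorem IsSeparated.not_connected {G : SimpleGraph (Fin n)} {π : PartialSetPartition n}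
    (hπ : IsSeparated G π) (h2 : TwoBlocks π) :
    ¬ (G.induce (π.ground : Set (Fin n))).Connected := by
  intro hc
  obtain ⟨B, hB, B', hB', hne⟩ := Finset.one_lt_card.mp h2
  obtain ⟨u, hu⟩ := π.nonempty_of_mem B hB
  obtain ⟨v, hv⟩ := π.nonempty_of_mem B' hB'
  have key : ∀ {x y : (π.ground : Set (Fin n))},
      (G.induce (π.ground : Set (Fin n))).Walk x y → x.1 ∈ B → y.1 ∈ B := by
    intro x y p
    induction p with
    | nil => exact id
    | @cons a b _ hadj _ ih =>
      intro ha
      obtain ⟨E, hE, hbE⟩ := mem_ground.mp (Finset.mem_coe.mp b.2)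
      obtain rfl := hπ B hB E hE a.1 ha b.1 hbE hadj
      exact ih hbE
  obtain ⟨p⟩ := hc.preconnected ⟨u, mem_ground.mpr ⟨B, hB, hu⟩⟩ ⟨v, mem_ground.mpr ⟨B', hB', hv⟩⟩
  exact hne (π.eq_of_mem_of_mem hB hB' (key p hu) hv)

end PartialSetPartition

theorem disjoint_compl_spouse {n : ℕ} (G : SimpleGraph (Fin n)) [DecidableRel G.Adj]
    (C : Finset (Fin n)) : Disjoint C (Finset.univ \ spouse G C) :=
  Finset.disjoint_sdiff.mono_left Finset.subset_union_left

open PartialSetPartition in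
theorem twoBlocks_and_isSeparated_of_mem_connectedSetMarkov {n : ℕ} {G : SimpleGraph (Fin n)}
    [DecidableRel G.Adj] {π : PartialSetPartition n} (hπ : π ∈ connectedSetMarkov G) :
    TwoBlocks π ∧ IsSeparated G π := by
  obtain ⟨C, hC, -, -, hb⟩ := hπ
  have hadj : ∀ u ∈ C, ∀ v ∈ Finset.univ \ spouse G C, ¬ G.Adj u v := by
    intro u hu v hv huv
    simp only [spouse, Finset.mem_sdiff, Finset.mem_union, Finset.mem_filter,
      Finset.mem_univ, true_and, not_or] at hv
    exact hv.2 ⟨u, hu, huv⟩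
  refine ⟨?_, ?_⟩
  · rw [TwoBlocks, hb, Finset.card_pair ((disjoint_compl_spouse G C).ne hC.ne_empty)]
  · intro B hB B' hB' u hu v hv huv
    rw [hb, Finset.mem_insert, Finset.mem_singleton] at hB hB'
    rcases hB with rfl | rfl <;> rcases hB' with rfl | rfl
    · rfl
    · exact absurd huv (hadj u hu v hv)
    · exact absurd huv.symm (hadj v hv u hu)
    · rfl

/-- A nonempty vertex set `D` inducing a disconnected subgraph contains a connected proper
subset with no edges to the rest of `D`. -/
theorem exists_connected_ssubset_of_not_connected {n : ℕ} {G : SimpleGraph (Fin n)}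
    {D : Finset (Fin n)} (hD : D.Nonempty) (h : ¬ (G.induce (D : Set (Fin n))).Connected) :
    ∃ C ⊂ D, C.Nonempty ∧ (G.induce (C : Set (Fin n))).Connected ∧
      ∀ u ∈ C, ∀ v ∈ D \ C, ¬ G.Adj u v := by
  classical
  have hpre : ¬ (G.induce (D : Set (Fin n))).Preconnected := fun hp =>
    h { preconnected := hp, nonempty := hD.to_subtype }
  simp only [SimpleGraph.Preconnected, not_forall] at hpre
  obtain ⟨x, y, hxy⟩ := hpre
  let C : Finset (Fin n) := D.filter fun w =>
    ∃ hw : w ∈ D, (G.induce (D : Set (Fin n))).Reachable x ⟨w, hw⟩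
  have mem_C : ∀ w : (D : Set (Fin n)),
      w.1 ∈ C ↔ (G.induce (D : Set (Fin n))).Reachable x w := by
    intro w
    have hw : w.1 ∈ D := w.2
    simp [C, hw]
  have hCD : C ⊆ D := Finset.filter_subset _ _
  have hx : x.1 ∈ C := (mem_C x).mpr (SimpleGraph.Reachable.refl x)
  have key : ∀ {a b : (D : Set (Fin n))}, (G.induce (D : Set (Fin n))).Walk a b →
      ∀ (ha : a.1 ∈ C) (hb : b.1 ∈ C),
        (G.induce (C : Set (Fin n))).Reachable ⟨a.1, ha⟩ ⟨b.1, hb⟩ := by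
    intro a b p
    induction p with
    | nil => exact fun _ _ => SimpleGraph.Reachable.refl _
    | @cons a c _ hadj _ ih =>
      intro ha hb
      have hc : c.1 ∈ C := (mem_C c).mpr (((mem_C a).mp ha).trans hadj.reachable)
      have hac : (G.induce (C : Set (Fin n))).Adj ⟨a.1, ha⟩ ⟨c.1, hc⟩ := hadj
      exact hac.reachable.trans (ih hc hb)
  have hne : C ≠ D := fun hEq => hxy ((mem_C y).mp (by rw [hEq]; exact y.2))
  refine ⟨C, Finset.ssubset_iff_subset_ne.mpr ⟨hCD, hne⟩, ⟨x.1, hx⟩,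
    { preconnected := fun a b => ?_, nonempty := ⟨⟨x.1, hx⟩⟩ }, fun u hu v hv huv => ?_⟩
  · have ha := (mem_C ⟨a.1, hCD a.2⟩).mp a.2
    have hb := (mem_C ⟨b.1, hCD b.2⟩).mp b.2
    obtain ⟨p⟩ := ha.symm.trans hb
    exact key p a.2 b.2
  · rw [Finset.mem_sdiff] at hv
    have hadj : (G.induce (D : Set (Fin n))).Adj ⟨u, hCD hu⟩ ⟨v, hv.1⟩ := huv
    exact hv.2 ((mem_C ⟨v, hv.1⟩).mpr (((mem_C ⟨u, hCD hu⟩).mp hu).trans hadj.reachable))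

open PartialSetPartition in
/-- Let `C_G` be the split closure of the connected set Markov statements of `G`.  A
nonempty set `D` is disconnected with respect to `C_G` if and only if the induced
subgraph `G[D]` is disconnected. -/
theorem disconnected_wrt_markov_iff
    {n : ℕ} (G : SimpleGraph (Fin n)) [DecidableRel G.Adj]
    (D : Finset (Fin n)) (hD : D.Nonempty) :
    Disconnected (splitClosure (connectedSetMarkov G)) D ↔
      ¬ (G.induce (D : Set (Fin n))).Connected := by
  constructor
  · rintro ⟨π, hπ, rfl⟩
    have hsep := Set.mem_sInter.mp hπ {π | TwoBlocks π ∧ IsSeparated G π}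
      ⟨fun _ => twoBlocks_and_isSeparated_of_mem_connectedSetMarkov,
        isSplitClosedIdeal_isSeparated G⟩
    exact hsep.2.not_connected hsep.1
  · intro h
    obtain ⟨C, hCD, hC, hconn, hadj⟩ := exists_connected_ssubset_of_not_connected hD h
    have hrest : (D \ C).Nonempty := Finset.sdiff_nonempty.mpr hCD.2
    have hsub : D \ C ⊆ Finset.univ \ spouse G C := by
      intro v hv
      simp only [spouse, Finset.mem_sdiff, Finset.mem_union, Finset.mem_filter,
        Finset.mem_univ, true_and, not_or, not_exists, not_and]
      exact ⟨(Finset.mem_sdiff.mp hv).2, fun u hu => hadj u hu v hv⟩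
    refine ⟨pair C (D \ C) hC hrest Finset.disjoint_sdiff, ?_, ?_⟩
    · rintro E ⟨hE, -, hdown, -⟩
      exact hdown
        (pair C (Finset.univ \ spouse G C) hC (hrest.mono hsub) (disjoint_compl_spouse G C))
        (hE ⟨C, hC, hconn, hrest.mono hsub, rfl⟩) _ (twoBlocks_pair _ _ _)
        (pair_le_pair _ _ _ _ _ _ subset_rfl hsub)
    · rw [ground_pair, Finset.union_sdiff_of_subset hCD.1]
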